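/- arXiv:2602.18894 — 5 statements merged into one kernel-verified Lean document; each statement's English description precedes it below -/
import Mathlib

section
/- Let 2 < p < 6 and β = (p−2)/(6−p). For μ > 0 let I(μ) be the infimum of E_NLS(u) = (1/2)∫_ℝ |u′|² dx − (1/p)∫_ℝ |u|^p dx over all u : ℝ → ℝ in H¹(ℝ) with ∫_ℝ |u|² dx = μ. Then I(1) is finite and strictly negative, for every μ > 0 the infimum I(μ) is attained by some function in H¹(ℝ) with mass μ, and I(μ) = μ^{2β+1} · I(1) for all μ > 0. Equivalently, there exists θ > 0 depending only on p such that min over the mass-μ sphere of E_NLS equals −θ μ^{2β+1}. -/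
open MeasureTheory

/-- `u ∈ H¹(ℝ)` with (everywhere) derivative `u'`:
`u` is continuous, square integrable, differentiable with square-integrable derivative. -/
def InH1 (u u' : ℝ → ℝ) : Prop :=
  Continuous u ∧ Integrable (fun x => (u x) ^ 2) ∧
    (∀ x : ℝ, HasDerivAt u (u' x) x) ∧ Integrable (fun x => (u' x) ^ 2)

/-- The NLS energy `E_NLS(u) = (1/2)∫_ℝ |u′|² − (1/p)∫_ℝ |u|^p`. -/
noncomputable def ENLS (p : ℝ) (u u' : ℝ → ℝ) : ℝ :=
  (1 / 2) * (∫ x : ℝ, (u' x) ^ 2) - (1 / p) * ∫ x : ℝ, |u x| ^ p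

/-- The set of NLS energies attained by `H¹(ℝ)` functions of mass `μ`. -/
def ENLSLevels (p μ : ℝ) : Set ℝ :=
  {E : ℝ | ∃ u u' : ℝ → ℝ, InH1 u u' ∧ (∫ x : ℝ, (u x) ^ 2) = μ ∧ E = ENLS p u u'}

/-- `I(μ)`: the infimum of the NLS energy over the mass-`μ` sphere in `H¹(ℝ)`. -/
noncomputable def Ilevel (p μ : ℝ) : ℝ := sInf (ENLSLevels p μ)

open Filter Topology Set

/-- The potential `(2/p)(M^{p-2}s² - |s|^p)`. -/
noncomputable def potG (p M s : ℝ) : ℝ := (2 / p) * (M ^ (p - 2) * s ^ 2 - |s| ^ p)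

/-- Antiderivative of the square root of the potential. -/
noncomputable def potF (p M s : ℝ) : ℝ := ∫ t in (0:ℝ)..s, Real.sqrt (potG p M t)

lemma potG_cont (p M : ℝ) (hp : 2 < p) : Continuous (potG p M) := by
  unfold potG
  have : Continuous (fun s : ℝ => |s| ^ p) :=
    continuous_abs.rpow_const (fun x => Or.inr (by linarith))
  fun_prop

lemma abs_rpow_le (p M s : ℝ) (hp : 2 < p) (hs : |s| ≤ M) :
    |s| ^ p ≤ M ^ (p - 2) * s ^ 2 := by
  have h1 : |s| ^ p = |s| ^ (p - 2) * s ^ 2 := by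
    rw [← sq_abs, ← Real.rpow_natCast, ← Real.rpow_add_of_nonneg (abs_nonneg s) (by linarith) (by norm_num)]
    norm_num
  rw [h1]
  have := Real.rpow_le_rpow (abs_nonneg s) hs (by linarith : 0 ≤ p - 2)
  nlinarith [sq_nonneg s]

lemma potG_nonneg (p M s : ℝ) (hp : 2 < p) (hs : |s| ≤ M) : 0 ≤ potG p M s := by
  unfold potG
  have := abs_rpow_le p M s hp hs
  have : 0 ≤ 2 / p := by positivity
  apply mul_nonneg this; linarith

lemma potF_deriv (p M s : ℝ) (hp : 2 < p) :
    HasDerivAt (potF p M) (Real.sqrt (potG p M s)) s := by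
  have hc : Continuous (fun t => Real.sqrt (potG p M t)) := (potG_cont p M hp).sqrt
  exact (hc.integral_hasStrictDerivAt 0 s).hasDerivAt

lemma potF_zero (p M : ℝ) : potF p M 0 = 0 := by simp [potF]

lemma potF_neg (p M s : ℝ) : potF p M (-s) = - potF p M s := by
  unfold potF
  have h : ∀ t, potG p M (-t) = potG p M t := by intro t; simp [potG]
  have := intervalIntegral.integral_comp_neg (a := 0) (b := s) (fun t => Real.sqrt (potG p M t))
  simp only [h, neg_zero] at this
  rw [this, intervalIntegral.integral_symm]

lemma potF_scale (p M : ℝ) (hp : 2 < p) (hM : 0 < M) :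
    potF p M M = M ^ ((p + 2) / 2) * potF p 1 1 := by
  unfold potF
  have h := intervalIntegral.smul_integral_comp_mul_left (a := 0) (b := 1)
    (f := fun t => Real.sqrt (potG p M t)) M
  simp only [mul_zero, mul_one, smul_eq_mul] at h
  rw [← h, ← intervalIntegral.integral_const_mul, ← intervalIntegral.integral_const_mul]
  congr 1
  ext t
  have h1 : potG p M (M * t) = M ^ p * potG p 1 t := by
    unfold potG
    rw [abs_mul, abs_of_pos hM, Real.mul_rpow hM.le (abs_nonneg t), Real.one_rpow]
    have : M ^ p = M ^ (p - 2) * M ^ 2 := by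
      rw [← Real.rpow_natCast, ← Real.rpow_add hM]; norm_num
    rw [this]; ring
  rw [h1, Real.sqrt_mul (by positivity), ← mul_assoc]
  congr 1
  rw [Real.sqrt_eq_rpow, ← Real.rpow_mul hM.le]
  nth_rewrite 1 [← Real.rpow_one M]
  rw [← Real.rpow_add hM]
  congr 1; ring

lemma InH1.meas {u u' : ℝ → ℝ} (h : InH1 u u') : Measurable u' := by
  have : u' = deriv u := by ext x; exact (h.2.2.1 x).deriv.symm
  rw [this]; exact measurable_deriv u

lemma InH1.tendsto {u u' : ℝ → ℝ} (h : InH1 u u') :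
    Tendsto u atTop (𝓝 0) ∧ Tendsto u atBot (𝓝 0) := by
  have hm := h.meas
  obtain ⟨hc, h2, hd, h3⟩ := h
  have hd2 : ∀ x, HasDerivAt (fun x => u x ^ 2) (2 * u x * u' x) x := by
    intro x
    have := (hd x).fun_pow 2
    simpa using this
  have hi : Integrable (fun x => 2 * u x * u' x) := by
    refine (h2.add h3).mono' (by fun_prop) (Eventually.of_forall fun x => ?_)
    simp only [Real.norm_eq_abs, Pi.add_apply]
    rw [abs_le]
    constructor <;> nlinarith [sq_nonneg (u x - u' x), sq_nonneg (u x + u' x)]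
  have key : ∀ l : Filter ℝ, Tendsto (fun x => u x ^ 2) l (𝓝 0) → Tendsto u l (𝓝 0) := by
    intro l hl
    have := hl.sqrt
    simp only [Real.sqrt_sq_eq_abs, Real.sqrt_zero] at this
    exact (tendsto_zero_iff_abs_tendsto_zero _).2 this
  exact ⟨key _ (tendsto_zero_of_hasDerivAt_of_integrableOn_Ioi (a := 0) (fun x _ => hd2 x)
    hi.integrableOn h2.integrableOn), key _ (tendsto_zero_of_hasDerivAt_of_integrableOn_Iic (a := 0)
    (fun x _ => hd2 x) hi.integrableOn h2.integrableOn)⟩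

lemma InH1.integrable_rpow {u u' : ℝ → ℝ} (h : InH1 u u') (p M : ℝ) (hp : 2 < p)
    (hM : ∀ x, |u x| ≤ M) : Integrable (fun x => |u x| ^ p) := by
  refine (h.2.1.const_mul (M ^ (p - 2))).mono' ?_ (Eventually.of_forall fun x => ?_)
  · exact (h.1.abs.rpow_const (fun x => Or.inr (by linarith))).aestronglyMeasurable
  · rw [Real.norm_eq_abs, abs_of_nonneg (by positivity)]
    exact abs_rpow_le p M _ hp (hM x)

lemma InH1.integrable_potG {u u' : ℝ → ℝ} (h : InH1 u u') (p M : ℝ) (hp : 2 < p)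
    (hM : ∀ x, |u x| ≤ M) : Integrable (fun x => potG p M (u x)) :=
  ((h.2.1.const_mul (M ^ (p - 2))).sub (h.integrable_rpow p M hp hM)).const_mul (2 / p)

lemma flux_bound {u u' : ℝ → ℝ} (p M : ℝ) (hp : 2 < p)
    (hM : ∀ x, |u x| ≤ M) (x : ℝ) : ‖Real.sqrt (potG p M (u x)) * u' x‖ ≤
      1 / 2 * u' x ^ 2 + 1 / 2 * potG p M (u x) := by
  have := Real.sq_sqrt (potG_nonneg p M (u x) hp (hM x))
  rw [Real.norm_eq_abs, abs_le]
  constructor <;> nlinarith [sq_nonneg (Real.sqrt (potG p M (u x)) - u' x),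
    sq_nonneg (Real.sqrt (potG p M (u x)) + u' x)]

lemma InH1.flux {u u' : ℝ → ℝ} (h : InH1 u u') (p M : ℝ) (hp : 2 < p)
    (hM : ∀ x, |u x| ≤ M) (x₀ : ℝ) :
    Integrable (fun x => Real.sqrt (potG p M (u x)) * u' x) ∧
    ∫ x in Ioi x₀, Real.sqrt (potG p M (u x)) * u' x = - potF p M (u x₀) ∧
    ∫ x in Iic x₀, Real.sqrt (potG p M (u x)) * u' x = potF p M (u x₀) := by
  have hi : Integrable (fun x => Real.sqrt (potG p M (u x)) * u' x) := by
    refine ((h.2.2.2.const_mul (1/2)).add ((h.integrable_potG p M hp hM).const_mul (1/2))).mono'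
      ?_ (Eventually.of_forall fun x => flux_bound p M hp hM x)
    exact (((potG_cont p M hp).comp h.1).sqrt.measurable.mul h.meas).aestronglyMeasurable
  have hd : ∀ x, HasDerivAt (fun x => potF p M (u x)) (Real.sqrt (potG p M (u x)) * u' x) x :=
    fun x => (potF_deriv p M (u x) hp).comp x (h.2.2.1 x)
  have ht : Tendsto (potF p M) (𝓝 0) (𝓝 0) := by
    have := (potF_deriv p M 0 hp).continuousAt.tendsto
    rwa [potF_zero] at this
  refine ⟨hi, ?_, ?_⟩
  · rw [integral_Ioi_of_hasDerivAt_of_tendsto' (fun x _ => hd x) hi.integrableOn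
      (ht.comp h.tendsto.1)]; simp
  · rw [integral_Iic_of_hasDerivAt_of_tendsto' (fun x _ => hd x) hi.integrableOn
      (ht.comp h.tendsto.2)]; simp

lemma InH1.core {u u' : ℝ → ℝ} (h : InH1 u u') (p M : ℝ) (hp : 2 < p) (hM0 : 0 < M)
    (hM : ∀ x, |u x| ≤ M) (x₀ : ℝ) (hx : |u x₀| = M) :
    2 * potF p 1 1 * M ^ ((p + 2) / 2) ≤
      ENLS p u u' + 1 / p * M ^ (p - 2) * ∫ x, u x ^ 2 := by
  obtain ⟨hi, h1, h2⟩ := h.flux p M hp hM x₀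
  have hj : Integrable (fun x => 1 / 2 * u' x ^ 2 + 1 / 2 * potG p M (u x)) :=
    (h.2.2.2.const_mul (1/2)).add ((h.integrable_potG p M hp hM).const_mul (1/2))
  have b1 := norm_integral_le_of_norm_le (μ := volume.restrict (Ioi x₀)) hj.integrableOn
    (Eventually.of_forall (flux_bound (u' := u') p M hp hM))
  have b2 := norm_integral_le_of_norm_le (μ := volume.restrict (Iic x₀)) hj.integrableOn
    (Eventually.of_forall (flux_bound (u' := u') p M hp hM))
  rw [h1, norm_neg] at b1
  rw [h2] at b2
  have b3 := intervalIntegral.integral_Iic_add_Ioi (b := x₀) hj.integrableOn hj.integrableOn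
  have b4 : potF p M M ≤ ‖potF p M (u x₀)‖ := by
    rw [Real.norm_eq_abs]
    rcases abs_choice (u x₀) with h | h
    · rw [← h, hx]; exact le_abs_self _
    · have : u x₀ = - M := by linarith
      rw [this, potF_neg, abs_neg]; exact le_abs_self _
  have b5 : ∫ x, (1 / 2 * u' x ^ 2 + 1 / 2 * potG p M (u x)) =
      ENLS p u u' + 1 / p * M ^ (p - 2) * ∫ x, u x ^ 2 := by
    rw [integral_add (h.2.2.2.const_mul (1/2)) ((h.integrable_potG p M hp hM).const_mul (1/2)),
      integral_const_mul, integral_const_mul]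
    unfold potG ENLS
    rw [integral_const_mul, integral_sub (h.2.1.const_mul (M ^ (p - 2)))
      (h.integrable_rpow p M hp hM), integral_const_mul]
    ring
  rw [potF_scale p M hp hM0] at b4
  linarith

lemma InH1.exists_max {u u' : ℝ → ℝ} (h : InH1 u u') (hu : 0 < ∫ x, u x ^ 2) :
    ∃ x₀, (∀ x, |u x| ≤ |u x₀|) ∧ 0 < |u x₀| := by
  have : ∃ y, u y ≠ 0 := by
    by_contra! hc
    simp [hc] at hu
  obtain ⟨y, hy⟩ := this
  have hy' : 0 < |u y| := abs_pos.2 hy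
  have ht : Tendsto (fun x => |u x|) (cocompact ℝ) (𝓝 0) := by
    rw [cocompact_eq_atBot_atTop]
    have := (h.tendsto.2.sup h.tendsto.1).abs
    simpa using this
  obtain ⟨x₀, hx⟩ := h.1.abs.exists_forall_ge' y
    ((ht.eventually_lt_const hy').mono fun x hx => hx.le)
  exact ⟨x₀, hx, hy'.trans_le (hx y)⟩

/-- Frequency constant of the normalized soliton. -/
noncomputable def solC (p : ℝ) : ℝ := Real.sqrt (2 / p) * ((p - 2) / 2)

/-- Normalized soliton. -/
noncomputable def solW (p x : ℝ) : ℝ := Real.cosh (solC p * x) ^ (-(2 / (p - 2)))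

/-- Derivative of the normalized soliton. -/
noncomputable def solD (p x : ℝ) : ℝ :=
  -Real.sqrt (2 / p) * Real.sinh (solC p * x) * Real.cosh (solC p * x) ^ (-(2 / (p - 2)) - 1)

lemma solC_pos (p : ℝ) (hp : 2 < p) : 0 < solC p := by
  have : 0 < p - 2 := by linarith
  unfold solC; positivity

lemma hasDerivAt_coshpow (c s x : ℝ) : HasDerivAt (fun x => Real.cosh (c * x) ^ s)
    (c * s * Real.sinh (c * x) * Real.cosh (c * x) ^ (s - 1)) x := by
  have h1 : HasDerivAt (fun x => c * x) c x := by simpa using (hasDerivAt_id x).const_mul c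
  have h2 := (h1.cosh).rpow_const (p := s) (Or.inl (Real.cosh_pos _).ne')
  convert! h2 using 1; ring

lemma integrable_coshpow (c s : ℝ) (hc : 0 < c) (hs : 0 < s) :
    Integrable (fun x => Real.cosh (c * x) ^ (-s)) := by
  have hcont : Continuous (fun x => Real.cosh (c * x) ^ (-s)) :=
    (by fun_prop : Continuous fun x => Real.cosh (c * x)).rpow_const
      (fun x => Or.inl (Real.cosh_pos _).ne')
  have key : ∀ y z : ℝ, Real.exp z / 2 ≤ Real.cosh y →
      ‖Real.cosh y ^ (-s)‖ ≤ 2 ^ s * Real.exp (-s * z) := by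
    intro y z hyz
    rw [Real.norm_eq_abs, abs_of_nonneg (by positivity)]
    calc Real.cosh y ^ (-s) ≤ (Real.exp z / 2) ^ (-s) :=
          Real.rpow_le_rpow_of_nonpos (by positivity) hyz (by linarith)
      _ = 2 ^ s * Real.exp (-s * z) := by
          rw [Real.div_rpow (by positivity) (by norm_num), Real.rpow_neg (by norm_num : (0:ℝ) ≤ 2),
            ← Real.exp_mul, div_inv_eq_mul, mul_comm, mul_comm z]
  rw [← integrableOn_univ, ← Iic_union_Ioi (a := (0:ℝ))]
  refine IntegrableOn.union ?_ ?_
  · have := (integrableOn_exp_mul_Iic (a := s * c) (by positivity) 0).const_mul ((2:ℝ) ^ s)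
    refine Integrable.mono' this hcont.aestronglyMeasurable (Eventually.of_forall fun x => ?_)
    have := key (c * x) (-(c * x)) (by rw [Real.cosh_eq]; linarith [Real.exp_pos (c * x)])
    convert this using 3; ring
  · have := (integrableOn_exp_mul_Ioi (a := -(s * c)) (by nlinarith) 0).const_mul ((2:ℝ) ^ s)
    refine Integrable.mono' this hcont.aestronglyMeasurable (Eventually.of_forall fun x => ?_)
    have := key (c * x) (c * x) (by rw [Real.cosh_eq]; linarith [Real.exp_pos (-(c * x))])
    convert this using 3; ring

lemma solW_pos (p x : ℝ) : 0 < solW p x := Real.rpow_pos_of_pos (Real.cosh_pos _) _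

lemma solW_le_one (p x : ℝ) (hp : 2 < p) : solW p x ≤ 1 := by
  have : 0 < p - 2 := by linarith
  have : 0 < 2 / (p - 2) := by positivity
  exact Real.rpow_le_one_of_one_le_of_nonpos (Real.one_le_cosh _) (by linarith)

lemma solW_abs_le (p x : ℝ) (hp : 2 < p) : |solW p x| ≤ 1 := by
  rw [abs_of_pos (solW_pos p x)]; exact solW_le_one p x hp

lemma solW_zero (p : ℝ) : solW p 0 = 1 := by simp [solW]

lemma solW_deriv (p x : ℝ) (hp : 2 < p) : HasDerivAt (solW p) (solD p x) x := by
  have := hasDerivAt_coshpow (solC p) (-(2 / (p - 2))) x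
  convert! this using 1
  unfold solD solC
  have : p - 2 ≠ 0 := by linarith
  field_simp

lemma solW_sq (p x : ℝ) : solW p x ^ 2 = Real.cosh (solC p * x) ^ (-(4 / (p - 2))) := by
  unfold solW
  rw [← Real.rpow_natCast, ← Real.rpow_mul (Real.cosh_pos _).le]
  congr 1; push_cast; ring

lemma solW_rpow (p x : ℝ) (hp : 2 < p) :
    solW p x ^ p = Real.cosh (solC p * x) ^ (-(4 / (p - 2)) - 2) := by
  unfold solW
  rw [← Real.rpow_mul (Real.cosh_pos _).le]
  congr 1
  have : p - 2 ≠ 0 := by linarith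
  field_simp; ring

lemma sinh_sq_mul (p x : ℝ) (hp : 2 < p) : Real.sinh (solC p * x) ^ 2 *
    Real.cosh (solC p * x) ^ (-(4 / (p - 2)) - 2) = solW p x ^ 2 - solW p x ^ p := by
  rw [solW_sq, solW_rpow p x hp, Real.sinh_sq, sub_mul, one_mul, ← Real.rpow_natCast,
    ← Real.rpow_add (Real.cosh_pos _)]
  congr 2; push_cast; ring

lemma solD_sq (p x : ℝ) (hp : 2 < p) :
    solD p x ^ 2 = 2 / p * (solW p x ^ 2 - solW p x ^ p) := by
  rw [← sinh_sq_mul p x hp]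
  unfold solD
  rw [mul_pow, mul_pow, neg_sq, Real.sq_sqrt (by positivity), 
    ← Real.rpow_natCast (Real.cosh _ ^ (_ : ℝ)) 2,
    ← Real.rpow_mul (Real.cosh_pos _).le, mul_assoc]
  congr 3; push_cast; ring

lemma solD_sq' (p x : ℝ) (hp : 2 < p) : solD p x ^ 2 = potG p 1 (solW p x) := by
  rw [solD_sq p x hp, potG, abs_of_pos (solW_pos p x)]; simp

lemma solW_int (p : ℝ) (hp : 2 < p) : Integrable (fun x => solW p x ^ 2) := by
  simp only [solW_sq]
  have : 0 < p - 2 := by linarith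
  exact integrable_coshpow _ _ (solC_pos p hp) (by positivity)

lemma solW_int_p (p : ℝ) (hp : 2 < p) : Integrable (fun x => solW p x ^ p) := by
  simp only [solW_rpow p _ hp]
  have : 0 < p - 2 := by linarith
  have := integrable_coshpow (solC p) (4 / (p - 2) + 2) (solC_pos p hp) (by positivity)
  convert! this using 3; ring

lemma sol_inH1 (p : ℝ) (hp : 2 < p) : InH1 (solW p) (solD p) := by
  refine ⟨?_, solW_int p hp, fun x => solW_deriv p x hp, ?_⟩
  · exact continuous_iff_continuousAt.2 fun x => (solW_deriv p x hp).continuousAt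
  · simp only [solD_sq p _ hp]
    exact ((solW_int p hp).sub (solW_int_p p hp)).const_mul _

/-- The virial identity. -/
lemma sol_virial (p : ℝ) (hp : 2 < p) :
    4 * ∫ x, solW p x ^ 2 = (p + 2) * ∫ x, solW p x ^ p := by
  have h2 : 0 < p - 2 := by linarith
  have hH := sol_inH1 p hp
  have hd : ∀ x, HasDerivAt (fun x => Real.sinh (solC p * x) *
      Real.cosh (solC p * x) ^ (-(4 / (p - 2)) - 1))
      (solC p * ((p + 2) / (p - 2) * solW p x ^ p - 4 / (p - 2) * solW p x ^ 2)) x := by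
    intro x
    have h1 : HasDerivAt (fun x => solC p * x) (solC p) x := by
      simpa using (hasDerivAt_id x).const_mul (solC p)
    have h3 := h1.sinh.mul (hasDerivAt_coshpow (solC p) (-(4 / (p - 2)) - 1) x)
    convert! h3 using 1
    have e1 : Real.cosh (solC p * x) * Real.cosh (solC p * x) ^ (-(4 / (p - 2)) - 1)
        = solW p x ^ 2 := by
      rw [solW_sq]
      nth_rewrite 1 [← Real.rpow_one (Real.cosh (solC p * x))]
      rw [← Real.rpow_add (Real.cosh_pos _)]; congr 1; ring
    have e2 := sinh_sq_mul p x hp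
    have e3 : -(4 / (p - 2)) - 1 - 1 = -(4 / (p - 2)) - 2 := by ring
    rw [e3]
    have e4 : Real.cosh (solC p * x) * solC p * Real.cosh (solC p * x) ^ (-(4 / (p - 2)) - 1)
        = solC p * solW p x ^ 2 := by rw [← e1]; ring
    have e5 : Real.sinh (solC p * x) * (solC p * (-(4 / (p - 2)) - 1) * Real.sinh (solC p * x) *
        Real.cosh (solC p * x) ^ (-(4 / (p - 2)) - 2)) =
        solC p * (-(4 / (p - 2)) - 1) * (solW p x ^ 2 - solW p x ^ p) := by rw [← e2]; ring
    rw [e4, e5]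
    field_simp; ring
  have hi1 := ((solW_int_p p hp).const_mul ((p + 2) / (p - 2)))
  have hi2 := ((solW_int p hp).const_mul (4 / (p - 2)))
  have hi : Integrable (fun x => Real.sinh (solC p * x) *
      Real.cosh (solC p * x) ^ (-(4 / (p - 2)) - 1)) := by
    refine (solW_int p hp).mono' ?_ (Eventually.of_forall fun x => ?_)
    · exact (continuous_iff_continuousAt.2 fun x => (hd x).continuousAt).aestronglyMeasurable
    · have e1 : solW p x ^ 2 =
          Real.cosh (solC p * x) * Real.cosh (solC p * x) ^ (-(4 / (p - 2)) - 1) := by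
        rw [solW_sq]
        nth_rewrite 2 [← Real.rpow_one (Real.cosh (solC p * x))]
        rw [← Real.rpow_add (Real.cosh_pos _)]; congr 1; ring
      rw [e1, norm_mul, Real.norm_eq_abs, Real.norm_eq_abs, abs_of_nonneg
        (Real.rpow_nonneg (Real.cosh_pos _).le _ : 0 ≤ Real.cosh (solC p * x) ^ (-(4 / (p - 2)) - 1))]
      refine mul_le_mul_of_nonneg_right ?_ (Real.rpow_nonneg (Real.cosh_pos _).le _)
      apply abs_le_of_sq_le_sq _ (Real.cosh_pos _).le
      rw [Real.sinh_sq]; linarith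
  have h0 := integral_eq_zero_of_hasDerivAt_of_integrable hd ((hi1.sub hi2).const_mul _) hi
  rw [integral_const_mul, integral_sub hi1 hi2, integral_const_mul, integral_const_mul] at h0
  have h4 := (mul_eq_zero.1 h0).resolve_left (solC_pos p hp).ne'
  field_simp at h4
  linarith

lemma sol_potF (p : ℝ) (hp : 2 < p) : 2 * potF p 1 1 = ∫ x, solD p x ^ 2 := by
  have hH := sol_inH1 p hp
  obtain ⟨hi, h1, h2⟩ := hH.flux p 1 hp (fun x => solW_abs_le p x hp) 0
  rw [solW_zero] at h1 h2
  have hs : ∀ x, Real.sqrt (potG p 1 (solW p x)) = |solD p x| := by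
    intro x; rw [← solD_sq' p x hp, Real.sqrt_sq_eq_abs]
  have hc := solC_pos p hp
  have e1 : ∫ x in Ioi 0, Real.sqrt (potG p 1 (solW p x)) * solD p x =
      ∫ x in Ioi 0, -(solD p x ^ 2) := by
    refine setIntegral_congr_fun measurableSet_Ioi fun x hx => ?_
    have hx : 0 < x := hx
    have : solD p x ≤ 0 := by
      unfold solD
      have := Real.sinh_nonneg_iff.2 (mul_pos hc hx).le
      have h3 := Real.cosh_pos (solC p * x)
      have : 0 ≤ Real.sqrt (2 / p) * Real.sinh (solC p * x) *
        Real.cosh (solC p * x) ^ (-(2 / (p - 2)) - 1) := by positivity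
      linarith
    simp only [hs, abs_of_nonpos this]; ring
  have e2 : ∫ x in Iic 0, Real.sqrt (potG p 1 (solW p x)) * solD p x =
      ∫ x in Iic 0, (solD p x ^ 2) := by
    refine setIntegral_congr_fun measurableSet_Iic fun x hx => ?_
    have hx : x ≤ 0 := hx
    have : 0 ≤ solD p x := by
      unfold solD
      have := Real.sinh_nonpos_iff.2 (mul_nonpos_of_nonneg_of_nonpos hc.le hx)
      have h3 := Real.cosh_pos (solC p * x)
      have h4 : 0 ≤ -Real.sinh (solC p * x) := by linarith
      have : 0 ≤ Real.sqrt (2 / p) * (-Real.sinh (solC p * x)) *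
        Real.cosh (solC p * x) ^ (-(2 / (p - 2)) - 1) := by positivity
      linarith
    simp only [hs, abs_of_nonneg this]; ring
  rw [integral_neg] at e1
  have h5 := intervalIntegral.integral_Iic_add_Ioi (b := (0:ℝ)) (f := fun x => solD p x ^ 2)
    hH.2.2.2.integrableOn hH.2.2.2.integrableOn
  linarith

lemma sol_P_pos (p : ℝ) (hp : 2 < p) : 0 < ∫ x, solW p x ^ p := by
  have hc : Continuous (fun x => solW p x ^ p) :=
    (sol_inH1 p hp).1.rpow_const (fun x => Or.inl (solW_pos p x).ne')
  exact integral_pos_of_integrable_nonneg_nonzero (x := 0) hc (solW_int_p p hp)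
    (fun x => Real.rpow_nonneg (solW_pos p x).le _) (Real.rpow_pos_of_pos (solW_pos p 0) _).ne'

lemma young_aux (a b M N : ℝ) (hb : 0 < b) (hab : b < a) (hM : 0 < M) (hN : 0 < N) :
    a * N ^ (a - b) * M ^ b ≤ b * M ^ a + (a - b) * N ^ a := by
  have ha : 0 < a := hb.trans hab
  have h := Real.geom_mean_le_arith_mean2_weighted (w₁ := b / a) (w₂ := (a - b) / a)
    (p₁ := M ^ a) (p₂ := N ^ a) (by positivity) (div_nonneg (by linarith) ha.le)
    (by positivity) (by positivity) (by field_simp; ring)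
  rw [← Real.rpow_mul hM.le, ← Real.rpow_mul hN.le, mul_div_cancel₀ _ ha.ne',
    mul_div_cancel₀ _ ha.ne'] at h
  have h2 := mul_le_mul_of_nonneg_left h ha.le
  have h3 : a * (b / a * M ^ a + (a - b) / a * N ^ a) = b * M ^ a + (a - b) * N ^ a := by
    field_simp
  rw [h3] at h2
  linarith

/-- The minimal energy at mass `m N^{(6-p)/2}`, where `m` is the mass of the normalized soliton. -/
noncomputable def minE (p N : ℝ) : ℝ :=
  -((6 - p) / (4 * p) * (∫ x, solW p x ^ p)) * N ^ ((p + 2) / 2)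

lemma lower (p N : ℝ) (hp : 2 < p) (hp6 : p < 6) (hN : 0 < N) {u u' : ℝ → ℝ} (h : InH1 u u')
    (hm : ∫ x, u x ^ 2 = (∫ x, solW p x ^ 2) * N ^ ((6 - p) / 2)) :
    minE p N ≤ ENLS p u u' := by
  have hP := sol_P_pos p hp
  have hv := sol_virial p hp
  have hF := sol_potF p hp
  simp only [solD_sq p _ hp] at hF
  rw [integral_const_mul, integral_sub (solW_int p hp) (solW_int_p p hp)] at hF
  unfold minE
  set P := ∫ x, solW p x ^ p
  set m := ∫ x, solW p x ^ 2
  have hm0 : m = (p + 2) / 4 * P := by linarith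
  obtain ⟨x₀, hx, hx0⟩ := h.exists_max (by rw [hm, hm0]; positivity)
  have hc := h.core p _ hp hx0 hx x₀ rfl
  set M := |u x₀|
  have hy := young_aux ((p + 2) / 2) (p - 2) M N (by linarith) (by linarith) hx0 hN
  have e : (p + 2) / 2 - (p - 2) = (6 - p) / 2 := by ring
  rw [e] at hy
  rw [hF, hm, hm0] at hc
  have hy2 := mul_le_mul_of_nonneg_left hy (by positivity : 0 ≤ P / (2 * p))
  have e1 : 2 / p * ((p + 2) / 4 * P - P) * M ^ ((p + 2) / 2) =
    P / (2 * p) * ((p - 2) * M ^ ((p + 2) / 2)) := by field_simp; ring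
  have e2 : 1 / p * M ^ (p - 2) * ((p + 2) / 4 * P * N ^ ((6 - p) / 2)) =
    P / (2 * p) * ((p + 2) / 2 * N ^ ((6 - p) / 2) * M ^ (p - 2)) := by field_simp; ring
  have e3 : -((6 - p) / (4 * p) * P) * N ^ ((p + 2) / 2) =
    - (P / (2 * p) * ((6 - p) / 2 * N ^ ((p + 2) / 2))) := by field_simp; ring
  rw [e1, e2] at hc
  rw [e3]
  rw [mul_add] at hy2
  linarith

lemma attain (p N : ℝ) (hp : 2 < p) (hN : 0 < N) : ∃ u u' : ℝ → ℝ, InH1 u u' ∧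
    (∫ x, u x ^ 2 = (∫ x, solW p x ^ 2) * N ^ ((6 - p) / 2)) ∧ ENLS p u u' = minE p N := by
  have hH := sol_inH1 p hp
  have hv := sol_virial p hp
  set k := N ^ ((p - 2) / 2) with hk
  have hk0 : 0 < k := by positivity
  have hki : |k⁻¹| = k⁻¹ := abs_of_pos (by positivity)
  have hkk : k * k = N ^ (p - 2) := by rw [hk, ← Real.rpow_add hN]; congr 1; ring
  have i1 : ∫ x, (N * solW p (k * x)) ^ 2 = N ^ 2 * k⁻¹ * ∫ x, solW p x ^ 2 := by
    simp only [mul_pow]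
    rw [integral_const_mul, Measure.integral_comp_mul_left (fun x => solW p x ^ 2), hki, smul_eq_mul]
    ring
  have i2 : ∫ x, (N * (k * solD p (k * x))) ^ 2 = N ^ 2 * k * ∫ x, solD p x ^ 2 := by
    simp only [mul_pow]
    rw [integral_const_mul, integral_const_mul,
      Measure.integral_comp_mul_left (fun x => solD p x ^ 2), hki, smul_eq_mul]
    field_simp
  have i3 : ∫ x, |N * solW p (k * x)| ^ p = N ^ p * k⁻¹ * ∫ x, solW p x ^ p := by
    have : ∀ x, |N * solW p (k * x)| ^ p = N ^ p * solW p (k * x) ^ p := by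
      intro x
      rw [abs_of_pos (mul_pos hN (solW_pos _ _)), Real.mul_rpow hN.le (solW_pos _ _).le]
    simp only [this]
    rw [integral_const_mul, Measure.integral_comp_mul_left (fun x => solW p x ^ p), hki, smul_eq_mul]
    ring
  refine ⟨fun x => N * solW p (k * x), fun x => N * (k * solD p (k * x)), ⟨?_, ?_, ?_, ?_⟩, ?_, ?_⟩
  · have := hH.1
    fun_prop
  · simp only [mul_pow]
    exact (hH.2.1.comp_mul_left' hk0.ne').const_mul _
  · intro x
    have h1 : HasDerivAt (fun x => k * x) k x := by simpa using (hasDerivAt_id x).const_mul k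
    have := ((solW_deriv p (k * x) hp).comp x h1).const_mul N
    convert! this using 1; ring
  · simp only [mul_pow]
    exact ((hH.2.2.2.comp_mul_left' hk0.ne').const_mul _).const_mul _
  · rw [i1, mul_comm]
    congr 1
    rw [hk, ← Real.rpow_neg hN.le, ← Real.rpow_natCast, ← Real.rpow_add hN]
    congr 1; push_cast; ring
  · unfold ENLS minE
    rw [i2, i3]
    simp only [solD_sq p _ hp]
    rw [integral_const_mul, integral_sub (solW_int p hp) (solW_int_p p hp)]
    have e1 : N ^ 2 * k = N ^ ((p + 2) / 2) := by
      rw [hk, ← Real.rpow_natCast, ← Real.rpow_add hN]; congr 1; push_cast; ring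
    have e2 : N ^ p * k⁻¹ = N ^ ((p + 2) / 2) := by
      rw [hk, ← Real.rpow_neg hN.le, ← Real.rpow_add hN]; congr 1; ring
    rw [e1, e2]
    have : ∫ x, solW p x ^ 2 = (p + 2) / 4 * ∫ x, solW p x ^ p := by linarith
    rw [this]
    field_simp; ring

lemma levels_least (p μ : ℝ) (hp : 2 < p) (hp6 : p < 6) (hμ : 0 < μ) :
    IsLeast (ENLSLevels p μ) (minE p ((μ / ∫ x, solW p x ^ 2) ^ (2 / (6 - p)))) := by
  have hP := sol_P_pos p hp
  have hv := sol_virial p hp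
  have hm : 0 < ∫ x, solW p x ^ 2 := by
    have : 0 < (p + 2) * ∫ x, solW p x ^ p := by positivity
    linarith
  have hs : 0 < μ / ∫ x, solW p x ^ 2 := by positivity
  have hN : 0 < (μ / ∫ x, solW p x ^ 2) ^ (2 / (6 - p)) := by positivity
  have hmass : (∫ x, solW p x ^ 2) *
      ((μ / ∫ x, solW p x ^ 2) ^ (2 / (6 - p))) ^ ((6 - p) / 2) = μ := by
    rw [← Real.rpow_mul hs.le]
    have h6 : 6 - p ≠ 0 := by linarith
    have : 2 / (6 - p) * ((6 - p) / 2) = 1 := by field_simp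
    rw [this, Real.rpow_one]; field_simp
  constructor
  · obtain ⟨u, u', h1, h2, h3⟩ := attain p _ hp hN
    exact ⟨u, u', h1, h2.trans hmass, h3.symm⟩
  · rintro E ⟨u, u', h1, h2, rfl⟩
    exact lower p _ hp hp6 hN h1 (h2.trans hmass.symm)

lemma minE_neg (p N : ℝ) (hp : 2 < p) (hp6 : p < 6) (hN : 0 < N) : minE p N < 0 := by
  unfold minE
  have hP := sol_P_pos p hp
  have : 0 < 6 - p := by linarith
  have : 0 < ((6 - p) / (4 * p) * (∫ x, solW p x ^ p)) * N ^ ((p + 2) / 2) := by positivity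
  linarith

/-- Lemma 2, real-line part: `I(1)` is finite and strictly negative, the infimum
`I(μ)` is attained for every `μ > 0` (by the soliton), and `I(μ) = μ^{2β+1} I(1)`,
i.e. the minimum equals `−θ μ^{2β+1}` with `θ = −I(1) > 0`. -/
theorem soliton_ground_state (p : ℝ) (hp1 : 2 < p) (hp2 : p < 6) :
    (ENLSLevels p 1).Nonempty ∧ BddBelow (ENLSLevels p 1) ∧ Ilevel p 1 < 0 ∧
    (∀ μ : ℝ, 0 < μ → ∃ u u' : ℝ → ℝ, InH1 u u' ∧
      (∫ x : ℝ, (u x) ^ 2) = μ ∧ ENLS p u u' = Ilevel p μ) ∧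
    (∀ μ : ℝ, 0 < μ →
      Ilevel p μ = μ ^ (2 * ((p - 2) / (6 - p)) + 1) * Ilevel p 1) := by
  have hL := fun μ hμ => levels_least p μ hp1 hp2 hμ
  have hI : ∀ μ, 0 < μ → Ilevel p μ = minE p ((μ / ∫ x, solW p x ^ 2) ^ (2 / (6 - p))) :=
    fun μ hμ => (hL μ hμ).csInf_eq
  have hP := sol_P_pos p hp1
  have hv := sol_virial p hp1
  have hm : 0 < ∫ x, solW p x ^ 2 := by
    have : 0 < (p + 2) * ∫ x, solW p x ^ p := by positivity
    linarith
  refine ⟨⟨_, (hL 1 one_pos).1⟩, ⟨_, (hL 1 one_pos).2⟩, ?_, ?_, ?_⟩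
  · rw [hI 1 one_pos]
    exact minE_neg p _ hp1 hp2 (by positivity)
  · intro μ hμ
    obtain ⟨u, u', h1, h2, h3⟩ := (hL μ hμ).1
    exact ⟨u, u', h1, h2, by rw [hI μ hμ, h3]⟩
  · intro μ hμ
    rw [hI μ hμ, hI 1 one_pos]
    unfold minE
    have h6 : 6 - p ≠ 0 := by linarith
    have e : 2 * ((p - 2) / (6 - p)) + 1 = 2 / (6 - p) * ((p + 2) / 2) := by field_simp; ring
    rw [e, ← Real.rpow_mul (by positivity), ← Real.rpow_mul (by positivity),
      div_eq_mul_one_div μ, Real.mul_rpow hμ.le (by positivity)]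
    ring
end

section
/- Let 2 < p < 6, let C > 0, let W : ℝ → ℝ be measurable with W(x) ≥ W₋ for all x, and let μ > 0 and K ∈ ℝ. Suppose (u_n) is a sequence of functions in H¹(ℝ) such that for every n: ∫_ℝ |u_n|² dx = μ, the Gagliardo–Nirenberg inequality ∫_ℝ |u_n|^p dx ≤ C (∫_ℝ |u_n|² dx)^{(p/2+1)/2} (∫_ℝ |u_n′|² dx)^{(p/2-1)/2} holds, W·|u_n|² is integrable, and E_W(u_n) ≤ K, where E_W(u) = (1/2)∫_ℝ (|u′|² + W|u|²) dx − (1/p)∫_ℝ |u|^p dx. Then sup_n ∫_ℝ |u_n′|² dx < ∞; in particular (u_n) is bounded in H¹(ℝ). -/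
open MeasureTheory

/-- The energy with potential:
`E_W(u) = (1/2)∫(|u′|² + W|u|²) − (1/p)∫|u|^p`. -/
noncomputable def EW (p : ℝ) (W u u' : ℝ → ℝ) : ℝ :=
  (1 / 2) * (∫ x : ℝ, ((u' x) ^ 2 + W x * (u x) ^ 2)) -
    (1 / p) * ∫ x : ℝ, |u x| ^ p

/-- Lemma 3: a sequence of mass-`μ` functions with bounded energy, satisfying the
Gagliardo–Nirenberg inequality, has uniformly bounded derivatives in `L²`. -/
theorem minimizing_seq_bounded (p : ℝ) (hp1 : 2 < p) (hp2 : p < 6)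
    (C : ℝ) (hC : 0 < C)
    (W : ℝ → ℝ) (hW : Measurable W) (Wm : ℝ) (hWm : ∀ x : ℝ, Wm ≤ W x)
    (μ : ℝ) (hμ : 0 < μ) (K : ℝ)
    (u u' : ℕ → ℝ → ℝ)
    (hH1 : ∀ n, InH1 (u n) (u' n))
    (hmass : ∀ n, (∫ x : ℝ, (u n x) ^ 2) = μ)
    (hGN : ∀ n, (∫ x : ℝ, |u n x| ^ p) ≤
      C * (∫ x : ℝ, (u n x) ^ 2) ^ ((p / 2 + 1) / 2) *
        (∫ x : ℝ, (u' n x) ^ 2) ^ ((p / 2 - 1) / 2))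
    (hWint : ∀ n, Integrable (fun x => W x * (u n x) ^ 2))
    (hE : ∀ n, EW p W (u n) (u' n) ≤ K) :
    ∃ M : ℝ, ∀ n, (∫ x : ℝ, (u' n x) ^ 2) ≤ M := by
  set a : ℝ := (p / 2 - 1) / 2 with ha
  have ha1 : a < 1 := by rw [ha]; linarith
  have hp0 : 0 < p := by linarith
  set c : ℝ := 2 * ((1 / p) * (C * μ ^ ((p / 2 + 1) / 2))) with hc
  have hc0 : 0 < c := by positivity
  have ht : Filter.Tendsto (fun D : ℝ => D ^ (1 - a)) Filter.atTop Filter.atTop :=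
    tendsto_rpow_atTop (by linarith)
  obtain ⟨T, hT⟩ := Filter.eventually_atTop.1 (ht.eventually_ge_atTop (2 * c))
  refine ⟨max (max T 1) (2 * (2 * K - Wm * μ)), fun n => ?_⟩
  obtain ⟨-, hu2, -, hd2⟩ := hH1 n
  have hG := hGN n
  have hEn := hE n
  have hm := hmass n
  have hlow : Wm * μ ≤ ∫ x : ℝ, W x * (u n x) ^ 2 := by
    rw [← hm, ← integral_const_mul]
    exact integral_mono (hu2.const_mul Wm) (hWint n)
      (fun x => mul_le_mul_of_nonneg_right (hWm x) (sq_nonneg _))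
  rw [EW, integral_add hd2 (hWint n)] at hEn
  rw [hm] at hG
  set D : ℝ := ∫ x : ℝ, (u' n x) ^ 2 with hD
  by_cases hDT : D ≤ max T 1
  · exact hDT.trans (le_max_left _ _)
  · have hlt := not_le.1 hDT
    have hD1 : 1 < D := (le_max_right _ _).trans_lt hlt
    have hDT' : T ≤ D := ((le_max_left _ _).trans_lt hlt).le
    have h1 := hT D hDT'
    have hsplit : D ^ (1 - a) * D ^ a = D := by
      rw [← Real.rpow_add (by linarith)]
      simp
    have hpos : 0 ≤ D ^ a := Real.rpow_nonneg (by linarith) _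
    have h2 : 2 * c * D ^ a ≤ D := by
      calc 2 * c * D ^ a ≤ D ^ (1 - a) * D ^ a := mul_le_mul_of_nonneg_right h1 hpos
        _ = D := hsplit
    have h3 := mul_le_mul_of_nonneg_left hG (by positivity : 0 ≤ 1 / p)
    have h4 : 2 * (1 / p * (C * μ ^ ((p / 2 + 1) / 2) * D ^ a)) = c * D ^ a := by
      rw [hc]; ring
    refine le_trans ?_ (le_max_right _ _)
    linarith
end

section
/- Let 2 < p < 6, β = (p−2)/(6−p), and let I(1) < 0 denote the infimum of E_NLS(u) = (1/2)∫_ℝ |u′|² dx − (1/p)∫_ℝ |u|^p dx over u ∈ H¹(ℝ) with ∫_ℝ |u|² dx = 1. Let W : ℝ → ℝ be continuous and bounded with W(x) → 0 as |x| → ∞. Suppose (u_n) ⊂ H¹(ℝ) satisfies: W·|u_n|² is integrable for each n, u_n → 0 uniformly on every compact subset of ℝ, and ∫_ℝ |u_n|² dx → m with 0 < m < ∞. Then liminf_{n→∞} E_W(u_n) ≥ m^{2β+1} · I(1), where E_W(u) = (1/2)∫_ℝ (|u′|² + W|u|²) dx − (1/p)∫_ℝ |u|^p dx. Equivalently, with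 θ = −I(1), liminf E_W(u_n) ≥ −θ m^{2β+1}. -/
open MeasureTheory

/-- `I(1)`: the ground-state NLS energy level at unit mass on `ℝ`. -/
noncomputable def Ilevel1 (p : ℝ) : ℝ :=
  sInf {E : ℝ | ∃ u u' : ℝ → ℝ, InH1 u u' ∧ (∫ x : ℝ, (u x) ^ 2) = 1 ∧ E = ENLS p u u'}

/-- Lower bound by scaling: `M^{2β+1} I(1) ≤ E_NLS(u)` for mass `M > 0`. -/
theorem enls_scaling (p : ℝ) (hp1 : 2 < p) (hp2 : p < 6) (hI : Ilevel1 p < 0)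
    (u u' : ℝ → ℝ) (h : InH1 u u') (M : ℝ) (hM : 0 < M) (hu : (∫ x : ℝ, (u x) ^ 2) = M) :
    M ^ (2 * ((p - 2) / (6 - p)) + 1) * Ilevel1 p ≤ ENLS p u u' := by
  obtain ⟨h1, h2, h3, h4⟩ := h
  have h6 : 0 < 6 - p := by linarith
  set c : ℝ := M ^ (-2 / (6 - p)) with hc
  set k : ℝ := M ^ (-(p - 2) / (6 - p)) with hk
  set e : ℝ := 2 * ((p - 2) / (6 - p)) + 1 with he
  have hc0 : 0 < c := Real.rpow_pos_of_pos hM _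
  have hk0 : 0 < k := Real.rpow_pos_of_pos hM _
  have hkn : k ≠ 0 := hk0.ne'
  have hMe : 0 < M ^ e := Real.rpow_pos_of_pos hM _
  have hc2 : c ^ 2 = M ^ (-4 / (6 - p)) := by
    rw [hc, ← Real.rpow_natCast, ← Real.rpow_mul hM.le]
    congr 1; push_cast; ring
  have hcp : c ^ p = M ^ (-2 * p / (6 - p)) := by
    rw [hc, ← Real.rpow_mul hM.le]
    congr 1; ring
  have e1 : c ^ 2 * M = k := by
    rw [hc2, hk]
    nth_rewrite 2 [← Real.rpow_one M]
    rw [← Real.rpow_add hM]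
    congr 1; field_simp; ring
  have e2 : c ^ 2 * k * M ^ e = 1 := by
    rw [hc2, hk, ← Real.rpow_add hM, ← Real.rpow_add hM]
    rw [show -4 / (6 - p) + -(p - 2) / (6 - p) + e = 0 by rw [he]; field_simp; ring]
    exact Real.rpow_zero M
  have e3 : c ^ p * M ^ e = k := by
    rw [hcp, hk, ← Real.rpow_add hM]
    congr 1; rw [he]; field_simp; ring
  have i1 : ∫ x : ℝ, (c * u (k * x)) ^ 2 = 1 := by
    have : (fun x : ℝ => (c * u (k * x)) ^ 2) = fun x => c ^ 2 * (fun y => u y ^ 2) (k * x) := by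
      funext x; simp only; ring
    rw [this, integral_const_mul, Measure.integral_comp_mul_left (fun y => u y ^ 2) k, hu, abs_of_pos (inv_pos.2 hk0),
      smul_eq_mul, ← mul_assoc, mul_comm (c ^ 2), mul_assoc, e1]
    field_simp
  have i2 : ∫ x : ℝ, (c * (u' (k * x) * k)) ^ 2 = c ^ 2 * k * ∫ x, u' x ^ 2 := by
    have : (fun x : ℝ => (c * (u' (k * x) * k)) ^ 2)
        = fun x => c ^ 2 * k ^ 2 * (fun y => u' y ^ 2) (k * x) := by
      funext x; simp only; ring
    rw [this, integral_const_mul, Measure.integral_comp_mul_left (fun y => u' y ^ 2) k, abs_of_pos (inv_pos.2 hk0),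
      smul_eq_mul]
    field_simp
  have i3 : ∫ x : ℝ, |c * u (k * x)| ^ p = c ^ p * (k⁻¹ * ∫ x, |u x| ^ p) := by
    have : (fun x : ℝ => |c * u (k * x)| ^ p)
        = fun x => c ^ p * (fun y => |u y| ^ p) (k * x) := by
      funext x
      simp only
      rw [abs_mul, abs_of_pos hc0, Real.mul_rpow hc0.le (abs_nonneg _)]
    rw [this, integral_const_mul, Measure.integral_comp_mul_left (fun y => |u y| ^ p) k, abs_of_pos (inv_pos.2 hk0),
      smul_eq_mul]
  have hbdd : BddBelow {E : ℝ | ∃ u u' : ℝ → ℝ, InH1 u u' ∧ (∫ x : ℝ, (u x) ^ 2) = 1 ∧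
      E = ENLS p u u'} := by
    by_contra hb
    have := Real.sInf_of_not_bddBelow hb
    unfold Ilevel1 at hI
    linarith
  have hv : InH1 (fun x => c * u (k * x)) (fun x => c * (u' (k * x) * k)) := by
    refine ⟨by fun_prop, ?_, ?_, ?_⟩
    · have := (h2.comp_mul_left' hkn).const_mul (c ^ 2)
      refine this.congr (Filter.Eventually.of_forall fun x => ?_)
      simp only; ring
    · intro x
      have hl : HasDerivAt (fun x : ℝ => k * x) k x := by
        simpa using (hasDerivAt_id x).const_mul k
      exact ((h3 (k * x)).comp x hl).const_mul c
    · have := (h4.comp_mul_left' hkn).const_mul (c ^ 2 * k ^ 2)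
      refine this.congr (Filter.Eventually.of_forall fun x => ?_)
      simp only; ring
  have key : Ilevel1 p ≤ ENLS p (fun x => c * u (k * x)) (fun x => c * (u' (k * x) * k)) :=
    csInf_le hbdd ⟨_, _, hv, i1, rfl⟩
  have hfin : M ^ e * ENLS p (fun x => c * u (k * x)) (fun x => c * (u' (k * x) * k))
      = ENLS p u u' := by
    unfold ENLS
    rw [i2, i3]
    have : M ^ e * (1 / 2 * (c ^ 2 * k * ∫ x, u' x ^ 2)
        - 1 / p * (c ^ p * (k⁻¹ * ∫ x, |u x| ^ p)))
        = (c ^ 2 * k * M ^ e) * (1 / 2 * ∫ x, u' x ^ 2)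
        - (c ^ p * M ^ e) * k⁻¹ * (1 / p * ∫ x, |u x| ^ p) := by ring
    rw [this, e2, e3, mul_inv_cancel₀ hkn]
    ring
  rw [← hfin]
  exact mul_le_mul_of_nonneg_left key hMe.le

/-- The potential term tends to zero. -/
theorem potential_tendsto_zero
    (W : ℝ → ℝ) (B : ℝ) (hWb : ∀ x : ℝ, |W x| ≤ B)
    (hW0 : Filter.Tendsto W (Filter.cocompact ℝ) (nhds 0))
    (u : ℕ → ℝ → ℝ)
    (hu2 : ∀ n, Integrable (fun x => (u n x) ^ 2))
    (hloc : ∀ K : Set ℝ, IsCompact K → TendstoUniformlyOn u 0 Filter.atTop K)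
    (m : ℝ) (hm : 0 < m)
    (hmass : Filter.Tendsto (fun n => ∫ x : ℝ, (u n x) ^ 2) Filter.atTop (nhds m)) :
    Filter.Tendsto (fun n => ∫ x : ℝ, W x * (u n x) ^ 2) Filter.atTop (nhds 0) := by
  have hB : 0 ≤ B := (abs_nonneg _).trans (hWb 0)
  rw [Metric.tendsto_atTop']
  intro ε hε
  set η : ℝ := ε / (2 * (m + 1)) with hη
  have hη0 : 0 < η := by positivity
  have hev : ∀ᶠ x in Filter.cocompact ℝ, |W x| < η := by
    have := hW0.eventually (Metric.ball_mem_nhds (0 : ℝ) hη0)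
    filter_upwards [this] with x hx
    simpa [Real.dist_eq] using hx
  obtain ⟨K, hK, hKW⟩ := Filter.mem_cocompact.1 hev
  set V : ℝ := volume.real K with hV
  have hV0 : 0 ≤ V := measureReal_nonneg
  set δ : ℝ := ε / (4 * (B * V + 1)) with hδ
  have hδ0 : 0 < δ := by positivity
  have hs := Metric.tendstoUniformlyOn_iff.1 (hloc K hK) (Real.sqrt δ) (Real.sqrt_pos.2 hδ0)
  have hms : ∀ᶠ n in Filter.atTop, ∫ x : ℝ, (u n x) ^ 2 < m + 1 :=
    hmass.eventually_lt_const (by linarith)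
  obtain ⟨N, hN⟩ := Filter.eventually_atTop.1 (hs.and hms)
  refine ⟨N, fun n hn => ?_⟩
  obtain ⟨hn1, hn2⟩ := hN n hn.le
  rw [Real.dist_eq, sub_zero, ← Real.norm_eq_abs]
  have hind : Integrable (K.indicator fun _ : ℝ => B * δ) :=
    (integrable_indicator_iff hK.measurableSet).2
      (integrableOn_const hK.measure_lt_top.ne)
  have hb : ‖∫ x : ℝ, W x * (u n x) ^ 2‖ ≤
      ∫ x : ℝ, (η * (u n x) ^ 2 + K.indicator (fun _ : ℝ => B * δ) x) := by
    refine norm_integral_le_of_norm_le (((hu2 n).const_mul η).add hind)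
      (Filter.Eventually.of_forall fun x => ?_)
    rw [Real.norm_eq_abs, abs_mul, abs_of_nonneg (sq_nonneg (u n x))]
    by_cases hx : x ∈ K
    · rw [Set.indicator_of_mem hx]
      have h1 := hn1 x hx
      simp only [Pi.zero_apply, Real.dist_eq, zero_sub, abs_neg] at h1
      have h2 : u n x ^ 2 ≤ δ := by
        rw [← sq_abs, ← Real.sq_sqrt hδ0.le]
        exact pow_le_pow_left₀ (abs_nonneg _) h1.le 2
      have h3 : |W x| * u n x ^ 2 ≤ B * δ := mul_le_mul (hWb x) h2 (sq_nonneg _) hB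
      have h4 : 0 ≤ η * u n x ^ 2 := by positivity
      linarith
    · rw [Set.indicator_of_notMem hx, add_zero]
      have : |W x| < η := hKW hx
      exact mul_le_mul_of_nonneg_right this.le (sq_nonneg _)
  rw [integral_add ((hu2 n).const_mul η) hind, integral_const_mul,
    integral_indicator_const _ hK.measurableSet, smul_eq_mul] at hb
  have b1 : η * ∫ x : ℝ, (u n x) ^ 2 ≤ η * (m + 1) := mul_le_mul_of_nonneg_left hn2.le hη0.le
  have b2 : η * (m + 1) = ε / 2 := by rw [hη]; field_simp
  have b3 : V * (B * δ) ≤ ε / 4 := by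
    have : δ * (B * V + 1) = ε / 4 := by rw [hδ]; field_simp
    nlinarith
  linarith

/-- Lemma 4 on `ℝ`: if `u_n` vanishes locally uniformly and its mass tends to
`m ∈ (0,∞)`, then `liminf E_W(u_n) ≥ m^{2β+1} I(1) = −θ m^{2β+1}`. -/
theorem vanishing_lower_bound (p : ℝ) (hp1 : 2 < p) (hp2 : p < 6)
    (hI : Ilevel1 p < 0)
    (W : ℝ → ℝ) (hWc : Continuous W) (B : ℝ) (hWb : ∀ x : ℝ, |W x| ≤ B)
    (hW0 : Filter.Tendsto W (Filter.cocompact ℝ) (nhds 0))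
    (u u' : ℕ → ℝ → ℝ)
    (hH1 : ∀ n, InH1 (u n) (u' n))
    (hWint : ∀ n, Integrable (fun x => W x * (u n x) ^ 2))
    (hloc : ∀ K : Set ℝ, IsCompact K → TendstoUniformlyOn u 0 Filter.atTop K)
    (m : ℝ) (hm : 0 < m)
    (hmass : Filter.Tendsto (fun n => ∫ x : ℝ, (u n x) ^ 2) Filter.atTop (nhds m)) :
    m ^ (2 * ((p - 2) / (6 - p)) + 1) * Ilevel1 p ≤
      Filter.liminf (fun n => EW p W (u n) (u' n)) Filter.atTop := by
  have hEq : ∀ n, EW p W (u n) (u' n)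
      = ENLS p (u n) (u' n) + (1 / 2) * ∫ x : ℝ, W x * (u n x) ^ 2 := by
    intro n
    unfold EW ENLS
    rw [integral_add (hH1 n).2.2.2 (hWint n)]
    ring
  have hpot := potential_tendsto_zero W B hWb hW0 u (fun n => (hH1 n).2.1) hloc m hm hmass
  have hg : Filter.Tendsto (fun n => (∫ x : ℝ, (u n x) ^ 2) ^ (2 * ((p - 2) / (6 - p)) + 1)
      * Ilevel1 p + (1 / 2) * ∫ x : ℝ, W x * (u n x) ^ 2) Filter.atTop
      (nhds (m ^ (2 * ((p - 2) / (6 - p)) + 1) * Ilevel1 p)) := by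
    have := ((hmass.rpow_const (p := 2 * ((p - 2) / (6 - p)) + 1) (Or.inl hm.ne')).mul_const
      (Ilevel1 p)).add (hpot.const_mul (1 / 2))
    simpa using this
  have hev : ∀ a < m ^ (2 * ((p - 2) / (6 - p)) + 1) * Ilevel1 p,
      ∀ᶠ n in Filter.atTop, a ≤ EW p W (u n) (u' n) := by
    intro a ha
    filter_upwards [hg.eventually_const_lt ha, hmass.eventually_const_lt hm] with n h1 h2
    have := enls_scaling p hp1 hp2 hI (u n) (u' n) (hH1 n) _ h2 rfl
    rw [hEq n]
    linarith
  rw [Filter.liminf_eq]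
  by_cases hbd : BddAbove {a : ℝ | ∀ᶠ n in Filter.atTop, a ≤ EW p W (u n) (u' n)}
  · exact le_of_forall_lt_imp_le_of_dense fun a ha => le_csSup hbd (hev a ha)
  · rw [Real.sSup_of_not_bddAbove hbd]
    exact mul_nonpos_of_nonneg_of_nonpos (Real.rpow_nonneg hm.le _) hI.le
end

section
/- Let 2 < p < 6, let W : ℝ → ℝ be measurable, let 0 < α < μ, and let u ∈ H¹(ℝ) satisfy ∫_ℝ |u|² dx = μ − α, ∫_ℝ |u|^p dx > 0, and W·|u|² integrable. Define w(x) = √(μ/(μ−α)) · u(x). Then E_W(u) > (1 − α/μ) · E_W(w), where E_W(v) = (1/2)∫_ℝ (|v′|² + W|v|²) dx − (1/p)∫_ℝ |v|^p dx. -/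
open MeasureTheory

/-- Strict scaling inequality from the dichotomy case of Proposition 1: for
`u` of mass `μ − α` with `0 < α < μ` and `w = √(μ/(μ−α)) u`, one has
`E_W(u) > (1 − α/μ) E_W(w)`. -/
theorem dichotomy_scaling (p : ℝ) (hp1 : 2 < p) (hp2 : p < 6)
    (W : ℝ → ℝ) (hW : Measurable W)
    (α μ : ℝ) (hα : 0 < α) (hαμ : α < μ)
    (u u' : ℝ → ℝ) (hH1 : InH1 u u')
    (hmass : (∫ x : ℝ, (u x) ^ 2) = μ - α)
    (hpos : 0 < ∫ x : ℝ, |u x| ^ p)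
    (hWint : Integrable (fun x => W x * (u x) ^ 2)) :
    EW p W u u' >
      (1 - α / μ) *
        EW p W (fun x => Real.sqrt (μ / (μ - α)) * u x)
          (fun x => Real.sqrt (μ / (μ - α)) * u' x) := by
  have hd : 0 < μ - α := by linarith
  have hμ : 0 < μ := by linarith
  have hk : 1 < μ / (μ - α) := by rw [one_lt_div hd]; linarith
  have hk' : 1 - α / μ = (μ / (μ - α))⁻¹ := by
    rw [inv_div]; field_simp
  rw [hk']
  generalize μ / (μ - α) = k at hk
  have hk0 : 0 < k := by linarith
  have hs2 : Real.sqrt k ^ 2 = k := Real.sq_sqrt hk0.le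
  have hs1 : 1 < Real.sqrt k := by
    rw [Real.lt_sqrt (by norm_num)]; linarith
  have hs0 : 0 < Real.sqrt k := by linarith
  have hsp : k < Real.sqrt k ^ p := by
    calc k = Real.sqrt k ^ (2 : ℝ) := by rw [Real.rpow_two, hs2]
      _ < Real.sqrt k ^ p := Real.rpow_lt_rpow_of_exponent_lt hs1 hp1
  have h1 : (∫ x : ℝ, ((Real.sqrt k * u' x) ^ 2 + W x * (Real.sqrt k * u x) ^ 2))
      = k * ∫ x : ℝ, ((u' x) ^ 2 + W x * (u x) ^ 2) := by
    rw [← integral_const_mul]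
    congr 1
    funext x
    rw [mul_pow, mul_pow, hs2]; ring
  have h2 : (∫ x : ℝ, |Real.sqrt k * u x| ^ p)
      = Real.sqrt k ^ p * ∫ x : ℝ, |u x| ^ p := by
    rw [← integral_const_mul]
    congr 1
    funext x
    rw [abs_mul, abs_of_pos hs0, Real.mul_rpow hs0.le (abs_nonneg _)]
  unfold EW
  rw [h1, h2]
  generalize (∫ x : ℝ, ((u' x) ^ 2 + W x * (u x) ^ 2)) = A
  generalize (∫ x : ℝ, |u x| ^ p) = B at hpos
  generalize Real.sqrt k ^ p = t at hsp
  have hp0 : 0 < 1 / p := by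
    have : 0 < p := by linarith
    positivity
  have h3 : 1 < k⁻¹ * t := by
    rw [inv_mul_eq_div, one_lt_div hk0]; exact hsp
  have h4 : k⁻¹ * k = 1 := inv_mul_cancel₀ hk0.ne'
  have h5 : k⁻¹ * (1 / 2 * (k * A) - 1 / p * (t * B))
      = 1 / 2 * A - (k⁻¹ * t) * (1 / p * B) := by
    linear_combination (1 / 2 * A) * h4
  rw [h5]
  have h6 : 0 < 1 / p * B := mul_pos hp0 hpos
  nlinarith
end

section
/- Let 2 < p < 6, β = (p−2)/(6−p), θ > 0, W₋ ∈ ℝ, and let W : ℝ → ℝ be measurable with W(x) ≥ W₋ for all x. Let μ > 0 and let u ∈ H¹(ℝ) satisfy ∫_ℝ |u|² dx = μ, W·|u|² integrable, and E_W(u) ≤ −(θ/2) μ^{2β+1}, where E_W(u) = (1/2)∫_ℝ (|u′|² + W|u|²) dx − (1/p)∫_ℝ |u|^p dx. Then (sup_{x∈ℝ} |u(x)|)^{p−2} ≥ (pθ/2) μ^{2β} + (p/2) W₋. -/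
open MeasureTheory

/-- Quantitative `L^∞` lower bound from the proof of Proposition 2: a function
of mass `μ` with energy `≤ −(θ/2) μ^{2β+1}` satisfies
`‖u‖_∞^{p−2} ≥ (pθ/2) μ^{2β} + (p/2) W₋`. -/
theorem linfty_lower_bound (p : ℝ) (hp1 : 2 < p) (hp2 : p < 6)
    (θ : ℝ) (hθ : 0 < θ)
    (Wm : ℝ) (W : ℝ → ℝ) (hW : Measurable W) (hWm : ∀ x : ℝ, Wm ≤ W x)
    (μ : ℝ) (hμ : 0 < μ)
    (u u' : ℝ → ℝ) (hH1 : InH1 u u')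
    (hmass : (∫ x : ℝ, (u x) ^ 2) = μ)
    (hWint : Integrable (fun x => W x * (u x) ^ 2))
    (hE : EW p W u u' ≤ -(θ / 2) * μ ^ (2 * ((p - 2) / (6 - p)) + 1)) :
    (⨆ x : ℝ, |u x|) ^ (p - 2) ≥
      (p * θ / 2) * μ ^ (2 * ((p - 2) / (6 - p))) + (p / 2) * Wm := by
  obtain ⟨hc, hu2, hd, hdu2⟩ := hH1
  have hderiv : deriv u = u' := funext fun x => (hd x).deriv
  have hmeas : Measurable u' := hderiv ▸ measurable_deriv u
  have hG : Integrable (fun x => (u x) ^ 2 + (u' x) ^ 2) := hu2.add hdu2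
  have hprod : Integrable (fun x => 2 * u x * u' x) := by
    refine hG.mono' ?_ (Filter.Eventually.of_forall fun x => ?_)
    · exact (((measurable_const.mul hc.measurable).mul hmeas)).aestronglyMeasurable
    · rw [Real.norm_eq_abs, abs_le]
      constructor <;> nlinarith [sq_nonneg (u x - u' x), sq_nonneg (u x + u' x)]
  have hsq : ∀ x, (u x) ^ 2 ≤ (u 0) ^ 2 + ∫ y, ‖2 * u y * u' y‖ := by
    intro x
    have h1 : ∫ y in (0:ℝ)..x, 2 * u y * u' y = (u x) ^ 2 - (u 0) ^ 2 := by
      refine intervalIntegral.integral_eq_sub_of_hasDerivAt (f := fun y => (u y) ^ 2) ?_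
        hprod.intervalIntegrable
      intro y _
      have h := (hd y).pow 2
      simp only [Nat.cast_ofNat, Nat.add_one_sub_one, pow_one] at h
      exact h
    have h2 : ‖∫ y in (0:ℝ)..x, 2 * u y * u' y‖ ≤ ∫ y, ‖2 * u y * u' y‖ :=
      intervalIntegral.norm_integral_le_integral_norm_uIoc.trans
        (setIntegral_le_integral hprod.norm (Filter.Eventually.of_forall fun y => norm_nonneg _))
    rw [h1] at h2
    have := (le_abs_self _).trans h2
    linarith
  have hbdd : BddAbove (Set.range fun x => |u x|) := by
    refine ⟨√((u 0) ^ 2 + ∫ y, ‖2 * u y * u' y‖), ?_⟩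
    rintro _ ⟨x, rfl⟩
    exact Real.abs_le_sqrt (hsq x)
  set M := ⨆ x : ℝ, |u x| with hM
  have hle : ∀ x, |u x| ≤ M := fun x => le_ciSup hbdd x
  have hLp : ∫ x : ℝ, |u x| ^ p ≤ M ^ (p - 2) * μ := by
    rw [← hmass, ← integral_const_mul]
    refine integral_mono_of_nonneg (Filter.Eventually.of_forall fun x => by positivity)
      (hu2.const_mul _) (Filter.Eventually.of_forall fun x => ?_)
    have h1 : |u x| ^ p = |u x| ^ (p - 2) * (u x) ^ 2 := by
      rw [← sq_abs (u x), ← Real.rpow_natCast (|u x|) 2,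
        ← Real.rpow_add_of_nonneg (abs_nonneg _) (by linarith) (by norm_num)]
      norm_num
    simp only [h1]
    gcongr
    exact hle x
  have hpot : Wm * μ ≤ ∫ x : ℝ, ((u' x) ^ 2 + W x * (u x) ^ 2) := by
    rw [← hmass, ← integral_const_mul]
    refine integral_mono (hu2.const_mul _) (hdu2.add hWint) fun x => ?_
    have := mul_le_mul_of_nonneg_right (hWm x) (sq_nonneg (u x))
    have := sq_nonneg (u' x)
    beta_reduce
    linarith
  unfold EW at hE
  rw [Real.rpow_add hμ, Real.rpow_one] at hE
  set A := μ ^ (2 * ((p - 2) / (6 - p)))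
  have hp0 : 0 < p := by linarith
  have h3 : (1 / p) * ∫ x : ℝ, |u x| ^ p ≤ (1 / p) * (M ^ (p - 2) * μ) := by gcongr
  have h4 : (1 / 2) * Wm * μ + θ / 2 * A * μ ≤ (1 / p) * (M ^ (p - 2)) * μ := by linarith
  have h5 : (1 / 2) * Wm + θ / 2 * A ≤ (1 / p) * (M ^ (p - 2)) := by
    refine le_of_mul_le_mul_right ?_ hμ
    linarith
  have h6 := mul_le_mul_of_nonneg_left h5 hp0.le
  have h7 : p * ((1 / p) * (M ^ (p - 2))) = M ^ (p - 2) := by field_simp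
  rw [h7] at h6
  show _ ≤ _
  linarith
end
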